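/- arXiv:1811.09981 — 2 statements merged into one kernel-verified Lean document; each statement's English description precedes it below -/
import Mathlib

section
/- Let A be an extremal d-dimensional (0,1)-matrix of order n and let Λ be an optimal hyperplane cover of A. Then A = A(Λ); that is, for every index α ∈ {1,…,n}^d, a_α = 1 if and only if ∑_{i=1}^d λ_{i,α_i} ≥ 1. -/
open Finset

/-- A d-dimensional matrix of order n is a (0,1)-matrix if all entries are 0 or 1. -/
def IsZeroOne {d n : ℕ} (A : (Fin d → Fin n) → ℝ) : Prop :=
  ∀ α, A α = 0 ∨ A α = 1

/-- A polyplex: nonnegative entries, each hyperplane sum at most 1. -/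
def IsPolyplex {d n : ℕ} (K : (Fin d → Fin n) → ℝ) : Prop :=
  (∀ α, 0 ≤ K α) ∧
  ∀ (i : Fin d) (j : Fin n),
    (∑ α : Fin d → Fin n, if α i = j then K α else 0) ≤ 1

/-- The weight of a polyplex: the sum of all its entries. -/
def plexWeight {d n : ℕ} (K : (Fin d → Fin n) → ℝ) : ℝ := ∑ α, K α

/-- K is contained in A: supp(K) ⊆ supp(A). -/
def ContainedIn {d n : ℕ} (K A : (Fin d → Fin n) → ℝ) : Prop :=
  ∀ α, K α ≠ 0 → A α ≠ 0

/-- The set of weights of polyplexes contained in A. -/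
def polyplexWeights {d n : ℕ} (A : (Fin d → Fin n) → ℝ) : Set ℝ :=
  {W | ∃ K, IsPolyplex K ∧ ContainedIn K A ∧ plexWeight K = W}

/-- A contains a polydiagonal: a polyplex of weight n. -/
def HasPolydiagonal {d n : ℕ} (A : (Fin d → Fin n) → ℝ) : Prop :=
  ∃ K, IsPolyplex K ∧ ContainedIn K A ∧ plexWeight K = (n : ℝ)

/-- A is extremal: no polydiagonal, but changing any zero entry to 1 creates one. -/
def IsExtremal {d n : ℕ} (A : (Fin d → Fin n) → ℝ) : Prop :=
  ¬ HasPolydiagonal A ∧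
  ∀ α, A α = 0 → HasPolydiagonal (Function.update A α (1 : ℝ))

/-- A hyperplane cover of A: nonnegative weights on hyperplanes covering supp(A). -/
def IsCover {d n : ℕ} (A : (Fin d → Fin n) → ℝ) (Λ : Fin d → Fin n → ℝ) : Prop :=
  (∀ i j, 0 ≤ Λ i j) ∧ ∀ α, A α ≠ 0 → 1 ≤ ∑ i, Λ i (α i)

/-- The weight of a hyperplane cover. -/
def coverWeight {d n : ℕ} (Λ : Fin d → Fin n → ℝ) : ℝ := ∑ i, ∑ j, Λ i j

/-- The set of weights of hyperplane covers of A. -/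
def coverWeights {d n : ℕ} (A : (Fin d → Fin n) → ℝ) : Set ℝ :=
  {W | ∃ Λ : Fin d → Fin n → ℝ, IsCover A Λ ∧ coverWeight Λ = W}

/-- Λ is an optimal hyperplane cover of A. -/
def IsOptimalCover {d n : ℕ} (A : (Fin d → Fin n) → ℝ) (Λ : Fin d → Fin n → ℝ) : Prop :=
  IsCover A Λ ∧ ∀ Λ' : Fin d → Fin n → ℝ, IsCover A Λ' → coverWeight Λ ≤ coverWeight Λ'

/-- K is an optimal polyplex contained in A. -/
def IsOptimalPolyplex {d n : ℕ} (A K : (Fin d → Fin n) → ℝ) : Prop :=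
  IsPolyplex K ∧ ContainedIn K A ∧
  ∀ K' : (Fin d → Fin n) → ℝ, IsPolyplex K' → ContainedIn K' A → plexWeight K' ≤ plexWeight K

/-- A(Λ): the (0,1)-matrix of indices covered with weight at least 1 by Λ. -/
noncomputable def matOf {d n : ℕ} (Λ : Fin d → Fin n → ℝ) : (Fin d → Fin n) → ℝ :=
  fun α => if 1 ≤ ∑ i, Λ i (α i) then (1 : ℝ) else 0

/-- A has deficiency δ: the maximum weight of a polyplex contained in A is n − δ. -/
def HasDeficiency {d n : ℕ} (A : (Fin d → Fin n) → ℝ) (δ : ℝ) : Prop :=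
  IsGreatest (polyplexWeights A) ((n : ℝ) - δ)

/-- Exchange of summation: pairing a matrix with a cover equals pairing its hyperplane sums with
the cover. -/
theorem sum_mul_cover_eq {d n : ℕ} (K : (Fin d → Fin n) → ℝ) (Λ : Fin d → Fin n → ℝ) :
    ∑ α, K α * ∑ i, Λ i (α i) = ∑ i, ∑ j, Λ i j * ∑ α, if α i = j then K α else 0 := by
  simp_rw [mul_sum]
  rw [sum_comm]
  refine sum_congr rfl fun i _ => ?_
  rw [sum_comm]
  refine sum_congr rfl fun α _ => ?_
  simp [mul_ite, mul_comm]

/-- Weak duality between polyplexes and hyperplane covers. -/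
theorem plexWeight_le_coverWeight {d n : ℕ} {A K : (Fin d → Fin n) → ℝ}
    {Λ : Fin d → Fin n → ℝ} (hK : IsPolyplex K) (hKA : ContainedIn K A) (hΛ : IsCover A Λ) :
    plexWeight K ≤ coverWeight Λ := by
  calc plexWeight K ≤ ∑ α, K α * ∑ i, Λ i (α i) := by
        refine sum_le_sum fun α _ => ?_
        by_cases h : K α = 0
        · simp [h]
        · exact le_mul_of_one_le_right (hK.1 α) (hΛ.2 α (hKA α h))
    _ = ∑ i, ∑ j, Λ i j * ∑ α, if α i = j then K α else 0 := sum_mul_cover_eq K Λ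
    _ ≤ coverWeight Λ := sum_le_sum fun i _ => sum_le_sum fun j _ =>
        mul_le_of_le_one_right (hΛ.1 i j) (hK.2 i j)

/-- The nonnegative matrices of weight `n` contained in `A`. -/
def weightSlice {d n : ℕ} (A : (Fin d → Fin n) → ℝ) : Set ((Fin d → Fin n) → ℝ) :=
  {K | (∀ α, 0 ≤ K α) ∧ ContainedIn K A ∧ plexWeight K = n}

theorem convex_weightSlice {d n : ℕ} (A : (Fin d → Fin n) → ℝ) : Convex ℝ (weightSlice A) := by
  rintro K ⟨hK, hKA, hKn⟩ L ⟨hL, hLA, hLn⟩ a b ha hb hab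
  refine ⟨fun α => ?_, fun α h hα => h ?_, ?_⟩
  · exact add_nonneg (mul_nonneg ha (hK α)) (mul_nonneg hb (hL α))
  · have h1 : K α = 0 := by_contra fun h => hKA α h hα
    have h2 : L α = 0 := by_contra fun h => hLA α h hα
    simp [h1, h2]
  · simp only [plexWeight, Pi.add_apply, Pi.smul_apply, smul_eq_mul, sum_add_distrib,
      ← mul_sum] at *
    rw [hKn, hLn, ← add_mul, hab, one_mul]

theorem isCompact_weightSlice {d n : ℕ} (A : (Fin d → Fin n) → ℝ) :
    IsCompact (weightSlice A) := by
  refine (isCompact_Icc (a := (0 : (Fin d → Fin n) → ℝ)) (b := fun _ => (n : ℝ))).of_isClosed_subset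
    ?_ ?_
  · have h : weightSlice A = (⋂ α, {K | 0 ≤ K α}) ∩
        ((⋂ α, ⋂ (_ : A α = 0), {K | K α = 0}) ∩ {K | plexWeight K = n}) := by
      ext K
      simp only [weightSlice, ContainedIn, Set.mem_inter_iff, Set.mem_iInter, Set.mem_ofPred_eq]
      simp only [ne_eq, not_imp_not]
    rw [h]
    refine (isClosed_iInter fun α => isClosed_le continuous_const (continuous_apply α)).inter
      ((isClosed_iInter fun α => isClosed_iInter fun _ =>
        isClosed_eq (continuous_apply α) continuous_const).inter
        (isClosed_eq ?_ continuous_const))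
    unfold plexWeight
    fun_prop
  · rintro K ⟨hK, -, hKn⟩
    refine ⟨hK, fun α => ?_⟩
    refine le_of_le_of_eq ?_ hKn
    exact single_le_sum (f := K) (fun β _ => hK β) (mem_univ α)

/-- The linear map sending a matrix to its family of hyperplane sums. -/
def hyperplaneSums (d n : ℕ) : ((Fin d → Fin n) → ℝ) →ₗ[ℝ] (Fin d × Fin n → ℝ) where
  toFun K p := ∑ α, if α p.1 = p.2 then K α else 0
  map_add' K L := by
    ext p
    simp only [Pi.add_apply, ← sum_add_distrib]
    exact sum_congr rfl fun α _ => by split_ifs <;> simp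
  map_smul' c K := by
    ext p
    simp [mul_sum]

/-- Strong duality at weight `n`: a matrix without polydiagonals has a hyperplane cover of weight
less than `n`. -/
theorem exists_isCover_coverWeight_lt {d n : ℕ} {A : (Fin d → Fin n) → ℝ}
    (hA : ¬ HasPolydiagonal A) : ∃ Λ, IsCover A Λ ∧ coverWeight Λ < n := by
  have hn : (0 : ℝ) < n := by
    rcases Nat.eq_zero_or_pos n with rfl | h
    · exact (hA ⟨0, ⟨fun _ => le_rfl, fun i j => by simp⟩, fun α h => (h rfl).elim,
        by simp [plexWeight]⟩).elim
    · exact_mod_cast h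
  have hdisj : Disjoint (hyperplaneSums d n '' weightSlice A) (Set.Iic 1) := by
    rw [Set.disjoint_left]
    rintro _ ⟨K, ⟨hK, hKA, hKn⟩, rfl⟩ h
    exact hA ⟨K, ⟨hK, fun i j => h (i, j)⟩, hKA, hKn⟩
  obtain ⟨f, u, v, hu, huv, hv⟩ := geometric_hahn_banach_compact_closed
    ((convex_weightSlice A).linear_image _)
    ((isCompact_weightSlice A).image (hyperplaneSums d n).continuous_of_finiteDimensional)
    (convex_Iic 1) isClosed_Iic hdisj
  set μ : Fin d × Fin n → ℝ := fun p => -f (Pi.single p 1) with hμ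
  have hf (x : Fin d × Fin n → ℝ) : f x = -∑ p, μ p * x p := by
    have := LinearMap.pi_apply_eq_sum_univ (f : (Fin d × Fin n → ℝ) →ₗ[ℝ] ℝ) x
    simp only [ContinuousLinearMap.coe_coe, smul_eq_mul] at this
    rw [this, ← sum_neg_distrib]
    refine sum_congr rfl fun p _ => ?_
    have : (fun j => if p = j then (1 : ℝ) else 0) = Pi.single p 1 := by
      ext j
      simp [Pi.single_apply, eq_comm]
    rw [this, hμ]
    ring
  have hsum : ∑ p, μ p < -u := by
    have h := hv 1 (Set.mem_Iic.2 le_rfl)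
    rw [hf] at h
    simp only [Pi.one_apply, mul_one] at h
    linarith
  have hnonneg (p : Fin d × Fin n) : 0 ≤ μ p := by
    by_contra! hp
    obtain ⟨N, hN⟩ := exists_nat_gt ((-v - ∑ q, μ q) / (-μ p))
    rw [div_lt_iff₀ (by linarith)] at hN
    have h := hv (1 - (N : ℝ) • Pi.single p 1) (by
      refine Set.mem_Iic.2 (sub_le_self _ (smul_nonneg N.cast_nonneg ?_))
      exact Pi.single_nonneg.2 zero_le_one)
    rw [map_sub, map_smul, hf 1] at h
    have hp' : f (Pi.single p 1) = -μ p := by simp [hμ]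
    rw [hp'] at h
    simp only [Pi.one_apply, mul_one, smul_eq_mul] at h
    linarith
  have hu0 : 0 < -u := (sum_nonneg fun p _ => hnonneg p).trans_lt hsum
  refine ⟨fun i j => n / -u * μ (i, j), ⟨fun i j => ?_, fun α hα => ?_⟩, ?_⟩
  · exact mul_nonneg (div_nonneg hn.le hu0.le) (hnonneg _)
  · have hmem : (Pi.single α (n : ℝ) : (Fin d → Fin n) → ℝ) ∈ weightSlice A := by
      refine ⟨fun β => ?_, fun β hβ => ?_, by simp [plexWeight]⟩
      · exact (Pi.single_nonneg.2 hn.le : (0 : (Fin d → Fin n) → ℝ) ≤ Pi.single α (n : ℝ)) β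
      · obtain rfl : β = α := by
          by_contra h
          exact hβ (Pi.single_eq_of_ne h _)
        exact hα
    have h := hu _ ⟨_, hmem, rfl⟩
    rw [hf, Fintype.sum_prod_type] at h
    have h2 := sum_mul_cover_eq (Pi.single α (n : ℝ)) fun i j => μ (i, j)
    simp only [hyperplaneSums, LinearMap.coe_mk, AddHom.coe_mk] at h
    rw [← h2, Fintype.sum_eq_single α fun β hβ => by simp [hβ], Pi.single_eq_same] at h
    rw [← mul_sum, div_mul_eq_mul_div, one_le_div hu0]
    linarith
  · simp only [coverWeight, ← mul_sum]
    rw [← Fintype.sum_prod_type, div_mul_eq_mul_div, div_lt_iff₀ hu0]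
    exact mul_lt_mul_of_pos_left hsum hn

/-- an extremal matrix equals the matrix defined by any of its
optimal hyperplane covers. -/
theorem stmt_4 (d n : ℕ) (A : (Fin d → Fin n) → ℝ) (hA : IsZeroOne A)
    (hE : IsExtremal A) (Λ : Fin d → Fin n → ℝ) (hΛ : IsOptimalCover A Λ) :
    ∀ α : Fin d → Fin n, A α = 1 ↔ 1 ≤ ∑ i, Λ i (α i) := by
  intro α
  refine ⟨fun h => hΛ.1.2 α (by simp [h]), fun h => (hA α).resolve_left fun h0 => ?_⟩
  obtain ⟨K, hK, hKA, hKn⟩ := hE.2 α h0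
  obtain ⟨M, hM, hMn⟩ := exists_isCover_coverWeight_lt hE.1
  have hcover : IsCover (Function.update A α 1) Λ := by
    refine ⟨hΛ.1.1, fun β hβ => ?_⟩
    by_cases hβα : β = α
    · exact hβα ▸ h
    · exact hΛ.1.2 β (by rwa [Function.update_of_ne hβα] at hβ)
  have hweak := plexWeight_le_coverWeight hK hKA hcover
  have hopt := hΛ.2 M hM
  linarith
end

section
/- Let A be an extremal d-dimensional (0,1)-matrix of order n with deficiency δ and let Λ be an optimal hyperplane cover of A. Then every entry λ_{i,j} of Λ with λ_{i,j} ≠ 0 and λ_{i,j} ≠ 1 satisfies δ ≤ λ_{i,j} ≤ 1 − δ. -/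
open Finset

/-- Weak duality between polyplexes and nonnegative hyperplane weights. -/
lemma IsPolyplex.sum_mul_le_coverWeight {d n : ℕ} {K : (Fin d → Fin n) → ℝ} (hK : IsPolyplex K)
    {Λ : Fin d → Fin n → ℝ} (hΛ : ∀ i j, 0 ≤ Λ i j) :
    ∑ α, K α * ∑ i, Λ i (α i) ≤ coverWeight Λ := by
  have h : ∑ α, K α * ∑ i, Λ i (α i)
      = ∑ i, ∑ j, Λ i j * ∑ α : Fin d → Fin n, if α i = j then K α else 0 := by
    simp_rw [mul_sum]
    rw [sum_comm]
    refine sum_congr rfl fun i _ => ?_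
    rw [sum_comm]
    refine sum_congr rfl fun α _ => ?_
    simp [mul_comm]
  rw [h]
  exact sum_le_sum fun i _ => sum_le_sum fun j _ =>
    mul_le_of_le_one_right (hΛ i j) (hK.2 i j)

lemma IsPolyplex.entry_le_one {d n : ℕ} {K : (Fin d → Fin n) → ℝ} (hK : IsPolyplex K)
    (i : Fin d) (α : Fin d → Fin n) : K α ≤ 1 := by
  refine le_trans ?_ (hK.2 i (α i))
  have h := single_le_sum (f := fun β : Fin d → Fin n => if β i = α i then K β else 0)
    (fun β _ => by split_ifs <;> simp [hK.1]) (mem_univ α)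
  simpa using h

lemma IsPolyplex.plexWeight_le {d n : ℕ} {K : (Fin d → Fin n) → ℝ} (hK : IsPolyplex K)
    (i : Fin d) : plexWeight K ≤ n := by
  have h := hK.sum_mul_le_coverWeight (Λ := fun k _ => if k = i then 1 else 0)
    (fun k _ => by split_ifs <;> norm_num)
  simpa [coverWeight, plexWeight] using h

/-- Strong duality, up to an arbitrarily small loss: if every polyplex contained in `A` has weight
at most `v`, then `A` has hyperplane covers of weight at most any `r > v`. -/
lemma exists_isCover_coverWeight_le {d n : ℕ} {A : (Fin d → Fin n) → ℝ} {v r : ℝ}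
    (hv : v ∈ upperBounds (polyplexWeights A)) (hr : v < r) :
    ∃ Λ, IsCover A Λ ∧ coverWeight Λ ≤ r := by
  have hv0 : 0 ≤ v := hv ⟨0, ⟨by simp, by simp⟩, by simp [ContainedIn], by simp [plexWeight]⟩
  obtain ⟨q, hvq, hqr⟩ := exists_between hr
  have hq : 0 < q := hv0.trans_lt hvq
  have hr0 : 0 < r := hq.trans hqr
  let S : Set (Fin d × Fin n → ℝ) := Set.univ.pi fun _ => Set.Iio q⁻¹
  let marg : ((Fin d → Fin n) → ℝ) → Fin d × Fin n → ℝ :=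
    fun K p => ∑ α : Fin d → Fin n, if α p.1 = p.2 then K α else 0
  let T : Set (Fin d × Fin n → ℝ) :=
    marg '' {K | (∀ α, 0 ≤ K α) ∧ ContainedIn K A ∧ plexWeight K = 1}
  have hSc : Convex ℝ S := convex_pi fun _ _ => convex_Iio _
  have hSo : IsOpen S := isOpen_set_pi Set.finite_univ fun _ _ => isOpen_Iio
  have hTc : Convex ℝ T := by
    rintro _ ⟨K, ⟨hK0, hKA, hK1⟩, rfl⟩ _ ⟨L, ⟨hL0, hLA, hL1⟩, rfl⟩ a b ha hb hab
    refine ⟨a • K + b • L, ⟨fun α => ?_, fun α hα => ?_, ?_⟩, ?_⟩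
    · have := hK0 α
      have := hL0 α
      simp only [Pi.add_apply, Pi.smul_apply, smul_eq_mul]
      positivity
    · by_contra! hA
      exact hα (by simp [not_imp_comm.1 (hKA α) (not_not.2 hA), not_imp_comm.1 (hLA α) (not_not.2 hA)])
    · simp only [plexWeight, Pi.add_apply, Pi.smul_apply, smul_eq_mul, sum_add_distrib,
        ← mul_sum] at hK1 hL1 ⊢
      rw [hK1, hL1]
      linarith
    · ext p
      simp only [marg, Pi.add_apply, Pi.smul_apply, smul_eq_mul, mul_sum, ← sum_add_distrib]
      refine sum_congr rfl fun α _ => ?_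
      split_ifs <;> simp
  have hST : Disjoint S T := by
    rw [Set.disjoint_left]
    rintro _ hS ⟨K, ⟨hK0, hKA, hK1⟩, rfl⟩
    have hle : q ≤ v := hv ⟨fun α => q * K α, ⟨fun α => mul_nonneg hq.le (hK0 α), fun i j => ?_⟩,
      fun α hα => hKA α (right_ne_zero_of_mul hα), ?_⟩
    · exact absurd hle (not_le.2 hvq)
    · have h : marg K (i, j) < q⁻¹ := hS (i, j) trivial
      have h' := mul_le_mul_of_nonneg_left h.le hq.le
      rw [mul_inv_cancel₀ hq.ne'] at h'
      simpa [marg, mul_sum, mul_ite] using h'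
    · simp only [plexWeight, ← mul_sum] at hK1 ⊢
      rw [hK1, mul_one]
  obtain ⟨f, u, hfS, hfT⟩ := geometric_hahn_banach_open hSc hSo hTc hST
  have hu : 0 < u := by
    simpa using hfS 0 (fun p _ => by simpa using hq)
  have hf : ∀ x, f x = ∑ i, ∑ j, x (i, j) * f (Pi.single (i, j) 1) := by
    intro x
    conv_lhs => rw [pi_eq_sum_univ' x]
    simp [map_sum, Fintype.sum_prod_type]
  have hf0 : ∀ p, 0 ≤ f (Pi.single p 1) := by
    intro p
    by_contra! hneg
    have h := hfS ((u / f (Pi.single p 1)) • Pi.single p 1) (fun k _ => by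
      have h1 : u / f (Pi.single p 1) < 0 := div_neg_of_pos_of_neg hu hneg
      have h2 : (0 : ℝ) < q⁻¹ := inv_pos.2 hq
      by_cases hk : k = p
      · subst hk
        simpa using h1.trans h2
      · simpa [hk] using hq)
    rw [map_smul, smul_eq_mul, div_mul_cancel₀ _ hneg.ne] at h
    exact lt_irrefl _ h
  refine ⟨fun i j => f (Pi.single (i, j) 1) / u, ⟨fun i j => div_nonneg (hf0 _) hu.le,
    fun α hα => ?_⟩, ?_⟩
  · have h := hfT (marg (Pi.single α 1)) ⟨Pi.single α 1, ⟨fun β => ?_, fun β hβ => ?_, ?_⟩, rfl⟩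
    · have hm : ∀ i j, marg (Pi.single α 1) (i, j) = if α i = j then 1 else 0 := by
        intro i j
        simp only [marg]
        rw [sum_eq_single α (fun β _ hβ => by simp [hβ]) (by simp)]
        simp
      rw [hf] at h
      simp only [hm, ite_mul, one_mul, zero_mul, sum_ite_eq, mem_univ, if_true] at h
      rw [← sum_div, one_le_div hu]
      exact h
    · by_cases hβ : β = α
      · subst hβ
        simp
      · simp [hβ]
    · by_cases h : β = α
      · rwa [h]
      · simp [h] at hβ
    · simp [plexWeight]
  · have h := hfS (fun _ => r⁻¹) (fun p _ => inv_strictAnti₀ hq hqr)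
    rw [hf] at h
    simp only [← mul_sum] at h
    simp only [coverWeight, ← sum_div]
    rw [div_le_iff₀ hu]
    rw [inv_mul_lt_iff₀ hr0] at h
    exact h.le

lemma IsOptimalCover.coverWeight_le {d n : ℕ} {A : (Fin d → Fin n) → ℝ} {v : ℝ}
    (hv : v ∈ upperBounds (polyplexWeights A)) {Λ : Fin d → Fin n → ℝ}
    (hΛ : IsOptimalCover A Λ) : coverWeight Λ ≤ v := by
  refine le_of_forall_gt_imp_ge_of_dense fun r hr => ?_
  obtain ⟨Λ', h, hle⟩ := exists_isCover_coverWeight_le hv hr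
  exact (hΛ.2 Λ' h).trans hle

/-- Every nonzero entry of an optimal cover participates in a tight covering constraint. -/
lemma IsOptimalCover.exists_sum_eq_one {d n : ℕ} {A : (Fin d → Fin n) → ℝ}
    {Λ : Fin d → Fin n → ℝ} (hΛ : IsOptimalCover A Λ) {i : Fin d} {j : Fin n} (hij : Λ i j ≠ 0) :
    ∃ α : Fin d → Fin n, α i = j ∧ ∑ k, Λ k (α k) = 1 := by
  by_contra! hne
  have hpos : 0 < Λ i j := (hΛ.1.1 i j).lt_of_ne' hij
  have hgt : ∀ α, A α ≠ 0 → α i = j → 0 < ∑ k, Λ k (α k) - 1 := fun α hα hj =>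
    sub_pos.2 ((hΛ.1.2 α hα).lt_of_ne' (hne α hj))
  have hev : ∀ᶠ ε in nhdsWithin (0 : ℝ) (Set.Ioi 0), 0 < ε ∧ ε < Λ i j ∧
      ∀ α, A α ≠ 0 → α i = j → ε < ∑ k, Λ k (α k) - 1 := by
    refine Filter.Eventually.and self_mem_nhdsWithin (Filter.Eventually.and ?_ ?_)
    · exact mem_nhdsWithin_of_mem_nhds (Iio_mem_nhds hpos)
    · refine Filter.eventually_all.2 fun α => ?_
      by_cases h : A α ≠ 0 ∧ α i = j
      · filter_upwards [mem_nhdsWithin_of_mem_nhds (Iio_mem_nhds (hgt α h.1 h.2))] with ε hε _ _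
        exact hε
      · exact Filter.Eventually.of_forall fun ε h1 h2 => absurd ⟨h1, h2⟩ h
  obtain ⟨ε, hε, hεΛ, hεα⟩ := hev.exists
  have hopt := hΛ.2 (fun a b => Λ a b - if a = i then if b = j then ε else 0 else 0)
    ⟨fun a b => ?_, fun α hα => ?_⟩
  · simp [coverWeight, sum_sub_distrib, sum_ite_irrel] at hopt
    linarith
  · dsimp only
    split_ifs with ha hb
    · subst ha hb
      linarith
    all_goals simpa using hΛ.1.1 a b
  · simp only [sum_sub_distrib, sum_ite_eq', mem_univ, if_true]
    split_ifs with h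
    · linarith [hεα α hα h]
    · simpa using hΛ.1.2 α hα

/-- In an optimal cover of weight less than the order, every direction has a zero entry. -/
lemma IsOptimalCover.exists_eq_zero {d n : ℕ} {A : (Fin d → Fin n) → ℝ}
    {Λ : Fin d → Fin n → ℝ} (hΛ : IsOptimalCover A Λ) (hw : coverWeight Λ < n) (i : Fin d) :
    ∃ j, Λ i j = 0 := by
  by_contra! hne
  have hpos : ∀ j, 0 < Λ i j := fun j => (hΛ.1.1 i j).lt_of_ne' (hne j)
  have hrow : ∑ j, Λ i j ≤ coverWeight Λ :=
    single_le_sum (f := fun k => ∑ j, Λ k j) (fun k _ => sum_nonneg fun j _ => hΛ.1.1 k j)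
      (mem_univ i)
  have hn : 0 < n := by
    have h0 : (0 : ℝ) ≤ coverWeight Λ := sum_nonneg fun k _ => sum_nonneg fun j _ => hΛ.1.1 k j
    exact_mod_cast h0.trans_lt hw
  obtain ⟨j₀, -, hmin⟩ := exists_min_image univ (Λ i) ⟨⟨0, hn⟩, mem_univ _⟩
  set m := Λ i j₀ with hm
  have hm0 : 0 < m := hpos j₀
  have hnm : n * m ≤ coverWeight Λ := by
    refine le_trans ?_ hrow
    have h := sum_le_sum hmin
    simpa using h
  have hnR : (0 : ℝ) < n := by exact_mod_cast hn
  have hm1 : 0 < 1 - m := by nlinarith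
  have hopt := hΛ.2 (fun a b => (Λ a b - if a = i then m else 0) / (1 - m))
    ⟨fun a b => div_nonneg ?_ hm1.le, fun α hα => ?_⟩
  · simp only [coverWeight, ← sum_div, sum_sub_distrib] at hopt
    rw [le_div_iff₀ hm1] at hopt
    simp [sum_ite_irrel] at hopt
    change coverWeight Λ * (1 - m) ≤ coverWeight Λ - n * m at hopt
    nlinarith
  · split_ifs with ha
    · subst ha
      exact sub_nonneg.2 (hmin b (mem_univ b))
    · simpa using hΛ.1.1 a b
  · simp only [← sum_div, sum_sub_distrib, sum_ite_eq', mem_univ, if_true]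
    rw [one_le_div hm1]
    linarith [hΛ.1.2 α hα]

/-- Positions outside the support of an extremal matrix are covered with weight at most `1 - δ`
by any cover of weight at most `n - δ`. -/
lemma IsExtremal.sum_le_of_eq_zero {d n : ℕ} {A : (Fin d → Fin n) → ℝ} (hE : IsExtremal A)
    {δ : ℝ} (hδ : 0 < δ) {Λ : Fin d → Fin n → ℝ} (hΛ : IsCover A Λ)
    (hw : coverWeight Λ ≤ n - δ) (i : Fin d) {α : Fin d → Fin n} (hα : A α = 0) :
    ∑ k, Λ k (α k) ≤ 1 - δ := by
  obtain ⟨K, hK, hKA, hKn⟩ := hE.2 α hα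
  have hweak := hK.sum_mul_le_coverWeight hΛ.1
  have hother : ∑ β ∈ univ.erase α, K β ≤ ∑ β ∈ univ.erase α, K β * ∑ k, Λ k (β k) := by
    refine sum_le_sum fun β hβ => ?_
    by_cases h : K β = 0
    · simp [h]
    · have hA : A β ≠ 0 := by simpa [ne_of_mem_erase hβ] using hKA β h
      exact le_mul_of_one_le_right (hK.1 β) (hΛ.2 β hA)
  rw [plexWeight, ← add_sum_erase _ _ (mem_univ α)] at hKn
  rw [← add_sum_erase _ _ (mem_univ α)] at hweak
  have h1 := hK.entry_le_one i α
  have h0 := hK.1 α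
  have hk : δ ≤ K α * (1 - ∑ k, Λ k (α k)) := by linarith
  have hs : 0 < 1 - ∑ k, Λ k (α k) := pos_of_mul_pos_right (hδ.trans_le hk) h0
  nlinarith

/-- every entry of an optimal cover different from 0 and 1 lies
between δ and 1 − δ. -/
theorem stmt_9 (d n : ℕ) (A : (Fin d → Fin n) → ℝ) (hA : IsZeroOne A)
    (hE : IsExtremal A) (δ : ℝ) (hδ : HasDeficiency A δ)
    (Λ : Fin d → Fin n → ℝ) (hΛ : IsOptimalCover A Λ) :
    ∀ (i : Fin d) (j : Fin n), Λ i j ≠ 0 → Λ i j ≠ 1 →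
      δ ≤ Λ i j ∧ Λ i j ≤ 1 - δ := by
  intro i j h0 h1
  have hδ0 : 0 < δ := by
    obtain ⟨K, hK, hKA, hKw⟩ := hδ.1
    have hle := hK.plexWeight_le i
    have hne : plexWeight K ≠ n := fun h => hE.1 ⟨K, hK, hKA, h⟩
    have hlt := hle.lt_of_ne hne
    linarith
  have hw : coverWeight Λ ≤ n - δ := hΛ.coverWeight_le hδ.2
  have hlower : ∀ i j, Λ i j ≠ 0 → δ ≤ Λ i j := by
    intro i j hij
    obtain ⟨α, rfl, hα⟩ := hΛ.exists_sum_eq_one hij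
    obtain ⟨j', hj'⟩ := hΛ.exists_eq_zero (by linarith) i
    have hpos : 0 < Λ i (α i) := (hΛ.1.1 i (α i)).lt_of_ne' hij
    have hsum : ∑ k, Λ k ((Function.update α i j' : Fin d → Fin n) k) = 1 - Λ i (α i) := by
      rw [← add_sum_erase _ _ (mem_univ i)] at hα ⊢
      have hrest : ∑ k ∈ univ.erase i, Λ k ((Function.update α i j' : Fin d → Fin n) k)
          = ∑ k ∈ univ.erase i, Λ k (α k) :=
        sum_congr rfl fun k hk => by rw [Function.update_of_ne (ne_of_mem_erase hk)]
      rw [hrest, Function.update_self, hj']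
      linarith
    have hzero : A (Function.update α i j') = 0 := by
      by_contra h
      linarith [hΛ.1.2 _ h]
    linarith [hE.sum_le_of_eq_zero hδ0 hΛ.1 hw i hzero]
  refine ⟨hlower i j h0, ?_⟩
  obtain ⟨α, rfl, hα⟩ := hΛ.exists_sum_eq_one h0
  rw [← add_sum_erase _ _ (mem_univ i)] at hα
  obtain ⟨k, hk, hk0⟩ : ∃ k ∈ univ.erase i, Λ k (α k) ≠ 0 := by
    refine exists_ne_zero_of_sum_ne_zero fun h => h1 ?_
    linarith
  have hle := single_le_sum (f := fun k => Λ k (α k)) (fun k _ => hΛ.1.1 k (α k)) hk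
  linarith [hlower k (α k) hk0]
end
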